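/- arXiv:1707.00274 — 2 statements merged into one kernel-verified Lean document; each statement's English description precedes it below -/
import Mathlib

section
/- Let X be a real inner product space, let 0 < γ ≤ 1/2, let x_1, …, x_n ∈ X and w_1, …, w_n ∈ ℝ, and let h_γ be the FBM-γ kernel. Then the finite kernel combination f(x) = Σ_{i=1}^n w_i h_γ(x_i, x) (an I-prior path) is Hölder of order 2γ: for all x, x' ∈ X, |f(x) − f(x')| ≤ (Σ_{i=1}^n |w_i|) · ‖x − x'‖^{2γ}. -/
theorem norm_rpow_le_norm_rpow_add_norm_sub_rpow {E : Type*} [SeminormedAddCommGroup E] {p : ℝ}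
    (hp0 : 0 ≤ p) (hp1 : p ≤ 1) (a b : E) : ‖a‖ ^ p ≤ ‖b‖ ^ p + ‖a - b‖ ^ p := by
  calc ‖a‖ ^ p ≤ (‖b‖ + ‖a - b‖) ^ p :=
        Real.rpow_le_rpow (norm_nonneg a) (norm_le_norm_add_norm_sub' a b) hp0
    _ ≤ ‖b‖ ^ p + ‖a - b‖ ^ p := by
        exact_mod_cast NNReal.rpow_add_le_add_rpow ‖b‖₊ ‖a - b‖₊ hp0 hp1

theorem abs_norm_rpow_sub_norm_rpow_le {E : Type*} [SeminormedAddCommGroup E] {p : ℝ}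
    (hp0 : 0 ≤ p) (hp1 : p ≤ 1) (a b : E) : |‖a‖ ^ p - ‖b‖ ^ p| ≤ ‖a - b‖ ^ p := by
  have hab := norm_rpow_le_norm_rpow_add_norm_sub_rpow hp0 hp1 a b
  have hba := norm_rpow_le_norm_rpow_add_norm_sub_rpow hp0 hp1 b a
  rw [norm_sub_rev b a] at hba
  exact abs_sub_le_iff.2 ⟨by linarith, by linarith⟩


/-- For `0 < γ ≤ 1/2`, an I-prior path `f(x) = ∑ᵢ wᵢ h_γ(xᵢ, x)` built from the FBM-γ kernel
is Hölder of order `2γ` with constant `∑ᵢ |wᵢ|`. -/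
theorem stmt_10 {X : Type*} [NormedAddCommGroup X] [InnerProductSpace ℝ X]
    {γ : ℝ} (hγ0 : 0 < γ) (hγ1 : γ ≤ 1/2)
    {n : ℕ} (xs : Fin n → X) (w : Fin n → ℝ)
    (hγfun : X → X → ℝ)
    (hdef : ∀ a b : X, hγfun a b =
      -(1/2) * (‖a - b‖ ^ (2 * γ) - ‖a‖ ^ (2 * γ) - ‖b‖ ^ (2 * γ)))
    (f : X → ℝ) (hf : ∀ a, f a = ∑ i, w i * hγfun (xs i) a) :
    ∀ x x' : X, |f x - f x'| ≤ (∑ i, |w i|) * ‖x - x'‖ ^ (2 * γ) := by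
  intro x x'
  have hp0 : 0 ≤ 2 * γ := by linarith
  have hp1 : 2 * γ ≤ 1 := by linarith
  have hker (a : X) : |hγfun a x - hγfun a x'| ≤ ‖x - x'‖ ^ (2 * γ) := by
    have h := abs_norm_rpow_sub_norm_rpow_le hp0 hp1 x x'
    have ha := abs_norm_rpow_sub_norm_rpow_le hp0 hp1 (a - x) (a - x')
    rw [sub_sub_sub_cancel_left, norm_sub_rev x' x] at ha
    rw [hdef, hdef]
    rw [abs_le] at h ha ⊢
    constructor <;> linarith
  rw [hf, hf, ← Finset.sum_sub_distrib, Finset.sum_mul]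
  refine (Finset.abs_sum_le_sum_abs _ _).trans (Finset.sum_le_sum fun i _ => ?_)
  rw [← mul_sub, abs_mul]
  exact mul_le_mul_of_nonneg_left (hker (xs i)) (abs_nonneg _)
end

section
/- Let X be a real inner product space, let 1/2 < γ < 1, let x_1, …, x_n ∈ X and w_1, …, w_n ∈ ℝ, and let h_γ be the FBM-γ kernel. Then the finite kernel combination f(x) = Σ_{i=1}^n w_i h_γ(x_i, x) (an I-prior path) is Hölder of order 2γ in the second-difference sense: for all x, t ∈ X, |f(x − t) − 2 f(x) + f(x + t)| ≤ (Σ_{i=1}^n |w_i|) · ‖t‖^{2γ}. -/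
/-- The symmetric second difference of `‖·‖ ^ p` is nonnegative for `1 ≤ p`. -/
theorem two_mul_norm_rpow_le_norm_add_rpow_add_norm_sub_rpow {X : Type*}
    [SeminormedAddCommGroup X] [NormedSpace ℝ X] {p : ℝ} (hp : 1 ≤ p) (u t : X) :
    2 * ‖u‖ ^ p ≤ ‖u + t‖ ^ p + ‖u - t‖ ^ p := by
  have hmid : ‖u‖ ≤ 1 / 2 * ‖u + t‖ + 1 / 2 * ‖u - t‖ := by
    have h := norm_add_le (u + t) (u - t)
    have h2 : (u + t) + (u - t) = (2 : ℝ) • u := by rw [two_smul]; abel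
    rw [h2, norm_smul, Real.norm_ofNat] at h
    linarith
  have hmono := Real.rpow_le_rpow (norm_nonneg u) hmid (by linarith : 0 ≤ p)
  have hconv := (convexOn_rpow hp).2 (norm_nonneg (u + t)) (norm_nonneg (u - t))
    (by norm_num : (0 : ℝ) ≤ 1 / 2) (by norm_num : (0 : ℝ) ≤ 1 / 2) (by norm_num)
  simp only [smul_eq_mul] at hconv
  linarith

/-- The symmetric second difference of `‖·‖ ^ (2 * γ)` is at most `2 * ‖t‖ ^ (2 * γ)`
for `0 ≤ γ ≤ 1`. -/
theorem norm_add_rpow_add_norm_sub_rpow_le {X : Type*} [SeminormedAddCommGroup X]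
    [InnerProductSpace ℝ X] {γ : ℝ} (hγ0 : 0 ≤ γ) (hγ1 : γ ≤ 1) (u t : X) :
    ‖u + t‖ ^ (2 * γ) + ‖u - t‖ ^ (2 * γ) ≤ 2 * ‖u‖ ^ (2 * γ) + 2 * ‖t‖ ^ (2 * γ) := by
  have hsq (a : X) : ‖a‖ ^ (2 * γ) = (‖a‖ ^ 2) ^ γ := by
    rw [Real.rpow_mul (norm_nonneg a), Real.rpow_two]
  simp only [hsq]
  have hconc := (Real.concaveOn_rpow hγ0 hγ1).2 (sq_nonneg ‖u + t‖) (sq_nonneg ‖u - t‖)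
    (by norm_num : (0 : ℝ) ≤ 1 / 2) (by norm_num : (0 : ℝ) ≤ 1 / 2) (by norm_num)
  simp only [smul_eq_mul] at hconc
  have hmid : 1 / 2 * ‖u + t‖ ^ 2 + 1 / 2 * ‖u - t‖ ^ 2 = ‖u‖ ^ 2 + ‖t‖ ^ 2 := by
    have := parallelogram_law_with_norm ℝ u t
    linarith
  rw [hmid] at hconc
  have hsub := Real.rpow_add_le_add_rpow (sq_nonneg ‖u‖) (sq_nonneg ‖t‖) hγ0 hγ1
  linarith

/-- For `1/2 < γ < 1`, an I-prior path `f(x) = ∑ᵢ wᵢ h_γ(xᵢ, x)` built from the FBM-γ kernel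
is Hölder of order `2γ` in the second-difference sense with constant `∑ᵢ |wᵢ|`. -/
theorem stmt_11 {X : Type*} [NormedAddCommGroup X] [InnerProductSpace ℝ X]
    {γ : ℝ} (hγ0 : 1/2 < γ) (hγ1 : γ < 1)
    {n : ℕ} (xs : Fin n → X) (w : Fin n → ℝ)
    (hγfun : X → X → ℝ)
    (hdef : ∀ a b : X, hγfun a b =
      -(1/2) * (‖a - b‖ ^ (2 * γ) - ‖a‖ ^ (2 * γ) - ‖b‖ ^ (2 * γ)))
    (f : X → ℝ) (hf : ∀ a, f a = ∑ i, w i * hγfun (xs i) a) :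
    ∀ x t : X, |f (x - t) - 2 * f x + f (x + t)| ≤ (∑ i, |w i|) * ‖t‖ ^ (2 * γ) := by
  intro x t
  have hterm (a : X) :
      |hγfun a (x - t) - 2 * hγfun a x + hγfun a (x + t)| ≤ ‖t‖ ^ (2 * γ) := by
    have hp : 1 ≤ 2 * γ := by linarith
    have hl := two_mul_norm_rpow_le_norm_add_rpow_add_norm_sub_rpow hp x t
    have hl' := two_mul_norm_rpow_le_norm_add_rpow_add_norm_sub_rpow hp (a - x) t
    have hu := norm_add_rpow_add_norm_sub_rpow_le (by linarith) hγ1.le x t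
    have hu' := norm_add_rpow_add_norm_sub_rpow_le (by linarith) hγ1.le (a - x) t
    rw [hdef, hdef, hdef, abs_le, sub_add_eq_sub_sub a x t, ← sub_add a x t]
    constructor <;> linarith
  have hsum : f (x - t) - 2 * f x + f (x + t) =
      ∑ i, w i * (hγfun (xs i) (x - t) - 2 * hγfun (xs i) x + hγfun (xs i) (x + t)) := by
    rw [hf, hf, hf, Finset.mul_sum, ← Finset.sum_sub_distrib, ← Finset.sum_add_distrib]
    exact Finset.sum_congr rfl fun i _ => by ring
  rw [hsum, Finset.sum_mul]
  refine (Finset.abs_sum_le_sum_abs _ _).trans (Finset.sum_le_sum fun i _ => ?_)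
  rw [abs_mul]
  exact mul_le_mul_of_nonneg_left (hterm (xs i)) (abs_nonneg _)
end
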